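/- arXiv:quant-ph/0610021 — 3 statements merged into one kernel-verified Lean document; each statement's English description precedes it below -/
import Mathlib

section
/- For any positive linear map Φ : M₂(ℂ) → Mₘ(ℂ), there exist finitely many matrices Vᵢ ∈ ℂ^{2×m} such that Φ(A) = Σᵢ Vᵢ* A Vᵢ for all symmetric matrices A ∈ M₂(ℂ) (A with Aᵀ = A). -/
open Matrix
open scoped ComplexOrder

section Factor
open scoped MatrixOrder Matrix.Norms.L2Operator

lemma aux_factor {n : Type*} [Fintype n] [DecidableEq n] {M : Matrix n n ℂ} (h : M.PosSemidef) :
    ∃ B : Matrix n n ℂ, M = Bᴴ * B := by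
  obtain ⟨B, hB⟩ := CStarAlgebra.nonneg_iff_eq_star_mul_self.mp h.nonneg
  exact ⟨B, hB⟩

end Factor

lemma aux_psd_trace {m : ℕ} {A B : Matrix (Fin m) (Fin m) ℂ} (hA : A.PosSemidef)
    (hB : B.PosSemidef) : 0 ≤ (A * B).trace := by
  obtain ⟨C, rfl⟩ := aux_factor hA
  rw [Matrix.mul_assoc, Matrix.trace_mul_comm]
  exact (hB.mul_mul_conjTranspose_same C).trace_nonneg

lemma aux_simdiag {m : ℕ} {X Z : Matrix (Fin m) (Fin m) ℂ} (hX : X.PosDef) (hZ : Z.IsHermitian) :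
    ∃ (G : Matrix (Fin m) (Fin m) ℂ) (l : Fin m → ℝ),
      X = Gᴴ * G ∧ Z = Gᴴ * diagonal (fun i => (l i : ℂ)) * G ∧
      Z * X⁻¹ * Z = Gᴴ * diagonal (fun i => (l i : ℂ) ^ 2) * G := by
  obtain ⟨R, hR⟩ := aux_factor hX.posSemidef
  have hRu : IsUnit R.det := by
    have := (Matrix.isUnit_iff_isUnit_det _).1 hX.isUnit
    rw [hR, Matrix.det_mul] at this
    exact isUnit_of_mul_isUnit_right this
  have hD : (R⁻¹ᴴ * Z * R⁻¹).IsHermitian := isHermitian_conjTranspose_mul_mul _ hZ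
  have hs := hD.spectral_theorem
  set U : Matrix (Fin m) (Fin m) ℂ := hD.eigenvectorUnitary.1 with hU
  have hUU : U * Uᴴ = 1 := Unitary.coe_mul_star_self hD.eigenvectorUnitary
  have hs' : R⁻¹ᴴ * Z * R⁻¹ = U * diagonal (fun i => (hD.eigenvalues i : ℂ)) * Uᴴ := by
    rw [Unitary.conjStarAlgAut_apply] at hs
    exact hs
  have hRi : R⁻¹ * R = 1 := Matrix.nonsing_inv_mul R hRu
  have hRi' : Rᴴ * R⁻¹ᴴ = 1 := by rw [← conjTranspose_mul, hRi, conjTranspose_one]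
  have h1 : X = (Uᴴ * R)ᴴ * (Uᴴ * R) := by
    rw [hR, conjTranspose_mul, conjTranspose_conjTranspose]
    calc Rᴴ * R = Rᴴ * (U * Uᴴ) * R := by rw [hUU, Matrix.mul_one]
      _ = _ := by simp only [Matrix.mul_assoc]
  have h2 : Z = (Uᴴ * R)ᴴ * diagonal (fun i => (hD.eigenvalues i : ℂ)) * (Uᴴ * R) := by
    rw [conjTranspose_mul, conjTranspose_conjTranspose]
    calc Z = (Rᴴ * R⁻¹ᴴ) * Z * (R⁻¹ * R) := by rw [hRi, hRi', Matrix.mul_one, Matrix.one_mul]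
      _ = Rᴴ * (R⁻¹ᴴ * Z * R⁻¹) * R := by simp only [Matrix.mul_assoc]
      _ = Rᴴ * (U * diagonal (fun i => (hD.eigenvalues i : ℂ)) * Uᴴ) * R :=
        congrArg (fun W => Rᴴ * W * R) hs'
      _ = _ := by simp only [Matrix.mul_assoc]
  refine ⟨Uᴴ * R, hD.eigenvalues, h1, h2, ?_⟩
  generalize Uᴴ * R = G at h1 h2
  have hGu : IsUnit G.det := by
    have := (Matrix.isUnit_iff_isUnit_det _).1 hX.isUnit
    rw [h1, Matrix.det_mul] at this
    exact isUnit_of_mul_isUnit_right this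
  have hG1 : G * G⁻¹ = 1 := Matrix.mul_nonsing_inv G hGu
  have hG2 : Gᴴ⁻¹ * Gᴴ = 1 := Matrix.nonsing_inv_mul _ (by
    rw [det_conjTranspose]; exact hGu.star)
  have h3 : X⁻¹ = G⁻¹ * Gᴴ⁻¹ := by rw [h1, Matrix.mul_inv_rev]
  rw [h3]
  generalize hl : hD.eigenvalues = l at *
  calc Z * (G⁻¹ * Gᴴ⁻¹) * Z
      = Gᴴ * diagonal (fun i => (l i : ℂ)) * (G * G⁻¹) * (Gᴴ⁻¹ * Gᴴ)
          * diagonal (fun i => (l i : ℂ)) * G := by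
        rw [h2]; simp only [Matrix.mul_assoc]
    _ = Gᴴ * (diagonal (fun i => (l i : ℂ)) * diagonal (fun i => (l i : ℂ))) * G := by
        rw [hG1, hG2]; simp only [Matrix.mul_assoc, Matrix.one_mul]
    _ = _ := by rw [diagonal_mul_diagonal]; simp only [pow_two]

lemma aux_dual_pd {m : ℕ} {X Y Z P Q H : Matrix (Fin m) (Fin m) ℂ} (hX : X.PosDef)
    (hZ : Z.IsHermitian) (hB : (fromBlocks X Z Z Y).PosSemidef) (hQ : Q.PosSemidef)
    (hP : ∀ t : ℝ, (P + (t : ℂ) • H + ((t : ℂ) ^ 2) • Q).PosSemidef) :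
    0 ≤ (X * P).trace + (Z * H).trace + (Y * Q).trace := by
  obtain ⟨G, l, h1, h2, h3⟩ := aux_simdiag hX hZ
  have hS : (Y - Z * X⁻¹ * Z).PosSemidef := by
    have : Invertible X := hX.isUnit.invertible
    have := (PosDef.fromBlocks₁₁ (A := X) Z Y hX).1 (by rwa [hZ.eq])
    rwa [hZ.eq] at this
  have h4 := aux_psd_trace hS hQ
  have key : ∀ (d : Fin m → ℂ) (W : Matrix (Fin m) (Fin m) ℂ),
      (Gᴴ * diagonal d * G * W).trace = ∑ i, d i * (G * W * Gᴴ) i i := by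
    intro d W
    rw [show Gᴴ * diagonal d * G * W = Gᴴ * (diagonal d * (G * W)) by simp only [Matrix.mul_assoc],
      Matrix.trace_mul_comm, Matrix.mul_assoc]
    simp [Matrix.trace, diagonal_mul]
  have h5 : (X * P).trace = ∑ i, (1 : ℂ) * (G * P * Gᴴ) i i := by
    rw [← key (fun _ => 1), h1]; simp
  have h6 : (Z * H).trace = ∑ i, (l i : ℂ) * (G * H * Gᴴ) i i := by rw [← key, ← h2]
  have h7 : (Z * X⁻¹ * Z * Q).trace = ∑ i, (l i : ℂ) ^ 2 * (G * Q * Gᴴ) i i := by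
    rw [h3, ← key (fun i => (l i : ℂ) ^ 2)]
  have h8 : 0 ≤ ∑ i, (G * (P + (l i : ℂ) • H + ((l i : ℂ) ^ 2) • Q) * Gᴴ) i i :=
    Finset.sum_nonneg fun i _ => ((hP (l i)).mul_mul_conjTranspose_same G).diag_nonneg
  have h9 : ∑ i, (G * (P + (l i : ℂ) • H + ((l i : ℂ) ^ 2) • Q) * Gᴴ) i i
      = (X * P).trace + (Z * H).trace + (Z * X⁻¹ * Z * Q).trace := by
    rw [h5, h6, h7, ← Finset.sum_add_distrib, ← Finset.sum_add_distrib]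
    refine Finset.sum_congr rfl fun i _ => ?_
    simp [Matrix.mul_add, Matrix.add_mul]
  rw [h9] at h8
  rw [Matrix.sub_mul, Matrix.trace_sub] at h4
  have := add_nonneg h8 h4
  convert this using 1
  ring

lemma aux_dual {m : ℕ} {X Y Z P Q H : Matrix (Fin m) (Fin m) ℂ}
    (hB : (fromBlocks X Z Z Y).PosSemidef) (hQ : Q.PosSemidef)
    (hP : ∀ t : ℝ, (P + (t : ℂ) • H + ((t : ℂ) ^ 2) • Q).PosSemidef) :
    0 ≤ ((X * P).trace + (Z * H).trace + (Y * Q).trace).re := by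
  have hH := hB.isHermitian
  rw [isHermitian_fromBlocks_iff] at hH
  have hX : X.PosSemidef := hB.submatrix Sum.inl
  have hP0 : P.PosSemidef := by simpa using hP 0
  have hZ : Z.IsHermitian := hH.2.1
  have main : ∀ e : ℝ, 0 < e →
      0 ≤ ((X * P).trace + (Z * H).trace + (Y * Q).trace).re + e * P.trace.re := by
    intro e he
    have hI : ((e : ℂ) • (1 : Matrix (Fin m) (Fin m) ℂ)).PosDef :=
      PosDef.one.smul (by exact_mod_cast he)
    have hb : (fromBlocks (X + (e : ℂ) • 1) Z Z Y).PosSemidef := by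
      have h0 : (fromBlocks ((e : ℂ) • (1 : Matrix (Fin m) (Fin m) ℂ)) 0 0
          (0 : Matrix (Fin m) (Fin m) ℂ)).PosSemidef := by
        have : Invertible ((e : ℂ) • (1 : Matrix (Fin m) (Fin m) ℂ)) := hI.isUnit.invertible
        have := (PosDef.fromBlocks₁₁ (A := (e : ℂ) • (1 : Matrix (Fin m) (Fin m) ℂ))
          (0 : Matrix (Fin m) (Fin m) ℂ) 0 hI).2 (by simpa using PosSemidef.zero)
        simpa using this
      have := hB.add h0
      simpa [fromBlocks_add] using this
    have := aux_dual_pd (hI.posSemidef_add hX) hZ hb hQ hP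
    have := (Complex.le_def.1 this).1
    simp [Matrix.add_mul] at this
    simp
    linarith
  refine le_of_forall_pos_le_add fun e he => ?_
  have hp : 0 ≤ P.trace.re := (Complex.le_def.1 hP0.trace_nonneg).1
  have := main (e / (P.trace.re + 1)) (by positivity)
  have h2 : e / (P.trace.re + 1) * P.trace.re ≤ e := by
    rw [div_mul_eq_mul_div, div_le_iff₀ (by positivity)]
    nlinarith
  linarith

lemma aux_riesz {m : ℕ} (g : Matrix (Fin m) (Fin m) ℂ →ₗ[ℂ] ℂ) :
    ∃ F : Matrix (Fin m) (Fin m) ℂ, ∀ X, g X = (F * X).trace := by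
  refine ⟨Matrix.of fun b a => g (Matrix.single a b 1), fun X => ?_⟩
  conv_lhs => rw [matrix_eq_sum_single X]
  simp only [map_sum, Matrix.trace, diag_apply, Matrix.mul_apply, of_apply]
  rw [Finset.sum_comm]
  refine Finset.sum_congr rfl fun i _ => Finset.sum_congr rfl fun j _ => ?_
  rw [show Matrix.single j i (X j i) = X j i • Matrix.single j i (1 : ℂ) by simp, map_smul,
    smul_eq_mul, mul_comm]

lemma aux_herm_trace {m : ℕ} (F P : Matrix (Fin m) (Fin m) ℂ) (hP : P.IsHermitian) :
    ((F + Fᴴ) * P).trace.re = 2 * (F * P).trace.re := by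
  have : (Fᴴ * P).trace = star (F * P).trace := by
    rw [← trace_conjTranspose, conjTranspose_mul, hP.eq, trace_mul_comm]
  rw [Matrix.add_mul, trace_add, this]
  simp; ring

lemma aux_trace_fromBlocks {m : ℕ} (A B C D : Matrix (Fin m) (Fin m) ℂ) :
    (fromBlocks A B C D).trace = A.trace + D.trace := by
  simp [Matrix.trace, Fintype.sum_sum_type]

/-- The compression map. -/
def auxT (m : ℕ) : Matrix (Fin m ⊕ Fin m) (Fin m ⊕ Fin m) ℂ →ₗ[ℂ]
    (Matrix (Fin m) (Fin m) ℂ × Matrix (Fin m) (Fin m) ℂ × Matrix (Fin m) (Fin m) ℂ) where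
  toFun M := (M.toBlocks₁₁, M.toBlocks₂₂, M.toBlocks₁₂ + M.toBlocks₂₁)
  map_add' M N := by
    refine Prod.ext ?_ (Prod.ext ?_ ?_) <;> ext i j <;>
      simp [toBlocks₁₁, toBlocks₂₂, toBlocks₁₂, toBlocks₂₁]
    abel
  map_smul' c M := by
    refine Prod.ext ?_ (Prod.ext ?_ ?_) <;> ext i j <;>
      simp [toBlocks₁₁, toBlocks₂₂, toBlocks₁₂, toBlocks₂₁]

/-- Functionals nonpositive on the cone are nonpositive at the target. -/
lemma aux_functional {m : ℕ} {P Q H : Matrix (Fin m) (Fin m) ℂ} (hQ : Q.PosSemidef)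
    (hH : H.IsHermitian)
    (hP : ∀ t : ℝ, (P + (t : ℂ) • H + ((t : ℂ) ^ 2) • Q).PosSemidef)
    (f : (Matrix (Fin m) (Fin m) ℂ × Matrix (Fin m) (Fin m) ℂ × Matrix (Fin m) (Fin m) ℂ) →ₗ[ℂ] ℂ)
    (hf : ∀ M : Matrix (Fin m ⊕ Fin m) (Fin m ⊕ Fin m) ℂ, M.PosSemidef → (f (auxT m M)).re ≤ 0) :
    (f (P, Q, H)).re ≤ 0 := by
  obtain ⟨F1, h1⟩ := aux_riesz (f ∘ₗ LinearMap.inl ℂ _ _)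
  obtain ⟨F2, h2⟩ := aux_riesz (f ∘ₗ LinearMap.inr ℂ _ _ ∘ₗ LinearMap.inl ℂ _ _)
  obtain ⟨F3, h3⟩ := aux_riesz (f ∘ₗ LinearMap.inr ℂ _ _ ∘ₗ LinearMap.inr ℂ _ _)
  have hfe : ∀ A B C, f (A, B, C) = (F1 * A).trace + (F2 * B).trace + (F3 * C).trace := by
    intro A B C
    rw [← h1, ← h2, ← h3]
    simp [← map_add]
  have hP0 : P.PosSemidef := by simpa using hP 0
  set N := fromBlocks F1 F3 F3 F2 with hN
  have hNT : ∀ M, f (auxT m M) = (N * M).trace := by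
    intro M
    conv_rhs => rw [← fromBlocks_toBlocks M]
    rw [hN, fromBlocks_multiply, aux_trace_fromBlocks]
    simp only [auxT, LinearMap.coe_mk, AddHom.coe_mk, hfe, trace_add, Matrix.mul_add]
    ring
  have hpsd : (-(N + Nᴴ)).PosSemidef := by
    refine PosSemidef.of_dotProduct_mulVec_nonneg ?_ fun w => ?_
    · rw [IsHermitian, conjTranspose_neg, conjTranspose_add, conjTranspose_conjTranspose, add_comm]
    · have := hf _ (posSemidef_vecMulVec_self_star w)
      rw [hNT, mul_vecMulVec, trace_vecMulVec, dotProduct_comm] at this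
      have e : star w ⬝ᵥ (Nᴴ *ᵥ w) = star (star w ⬝ᵥ (N *ᵥ w)) := by
        rw [star_dotProduct, star_mulVec, ← dotProduct_mulVec, conjTranspose_conjTranspose]
      rw [neg_mulVec, add_mulVec, dotProduct_neg, dotProduct_add, e, Complex.le_def]
      simp
      linarith
  have hpsd' : (fromBlocks (-(F1 + F1ᴴ)) (-(F3 + F3ᴴ)) (-(F3 + F3ᴴ)) (-(F2 + F2ᴴ))).PosSemidef := by
    rw [hN, fromBlocks_conjTranspose, fromBlocks_add, fromBlocks_neg] at hpsd
    exact hpsd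
  have := aux_dual hpsd' hQ hP
  simp only [Matrix.neg_mul, trace_neg, Complex.add_re, Complex.neg_re,
    aux_herm_trace _ _ hP0.isHermitian, aux_herm_trace _ _ hQ.isHermitian,
    aux_herm_trace _ _ hH] at this
  rw [hfe]
  simp only [Complex.add_re]
  linarith

section Topo
open scoped Matrix.Norms.Elementwise

lemma aux_exists {m : ℕ} {P Q H : Matrix (Fin m) (Fin m) ℂ} (hQ : Q.PosSemidef)
    (hH : H.IsHermitian)
    (hP : ∀ t : ℝ, (P + (t : ℂ) • H + ((t : ℂ) ^ 2) • Q).PosSemidef) :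
    ∃ B : Matrix (Fin m ⊕ Fin m) (Fin m ⊕ Fin m) ℂ, auxT m (Bᴴ * B) = (P, Q, H) := by
  set g : Matrix (Fin m ⊕ Fin m) (Fin m ⊕ Fin m) ℂ → _ := fun B => auxT m (Bᴴ * B) with hg
  have hgc : Continuous g := by
    have h1 : Continuous (auxT m) := LinearMap.continuous_of_finiteDimensional _
    exact h1.comp (by fun_prop)
  have hrange : ∀ M : Matrix (Fin m ⊕ Fin m) (Fin m ⊕ Fin m) ℂ, M.PosSemidef →
      auxT m M ∈ Set.range g := by
    intro M hM
    obtain ⟨B, rfl⟩ := aux_factor hM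
    exact ⟨B, rfl⟩
  have hconv : Convex ℝ (Set.range g) := by
    rintro _ ⟨A, rfl⟩ _ ⟨B, rfl⟩ a b ha hb -
    have : a • g A + b • g B = auxT m ((a : ℂ) • (Aᴴ * A) + (b : ℂ) • (Bᴴ * B)) := by
      rw [map_add, map_smul, map_smul]; rfl
    rw [this]
    apply hrange
    exact ((posSemidef_conjTranspose_mul_self A).smul (by exact_mod_cast ha)).add
      ((posSemidef_conjTranspose_mul_self B).smul (by exact_mod_cast hb))
  have hmem : (P, Q, H) ∈ closure (Set.range g) := by
    by_contra hnot
    have : LocallyConvexSpace ℝ (Matrix (Fin m) (Fin m) ℂ) := NormedSpace.toLocallyConvexSpace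
    obtain ⟨f, u, h1, h2⟩ := RCLike.geometric_hahn_banach_closed_point (𝕜 := ℂ)
      hconv.closure isClosed_closure hnot
    have h0 : 0 < u := by
      have := h1 _ (subset_closure (hrange 0 PosSemidef.zero))
      simpa using this
    have := aux_functional hQ hH hP f.toLinearMap (by
      intro M hM
      by_contra! hpos
      replace hpos : 0 < (f (auxT m M)).re := hpos
      have hc : 0 < u / (f (auxT m M)).re := div_pos h0 hpos
      have := h1 _ (subset_closure (hrange (((u / (f (auxT m M)).re : ℝ) : ℂ) • M)
        (hM.smul (by exact_mod_cast hc.le))))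
      rw [map_smul, map_smul, smul_eq_mul] at this
      simp only [RCLike.re_to_complex, Complex.re_ofReal_mul] at this
      rw [div_mul_cancel₀ _ (ne_of_gt hpos)] at this
      exact lt_irrefl _ this)
    have h3 : u < (f (P, Q, H)).re := h2
    have h4 : (f (P, Q, H)).re ≤ 0 := this
    linarith
  set τ : (Matrix (Fin m) (Fin m) ℂ × Matrix (Fin m) (Fin m) ℂ × Matrix (Fin m) (Fin m) ℂ) → ℝ :=
    fun x => (x.1.trace + x.2.1.trace).re with hτ
  have hτc : Continuous τ := by
    apply Complex.continuous_re.comp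
    exact (continuous_fst.matrix_trace).add ((continuous_fst.comp continuous_snd).matrix_trace)
  have hgτ : ∀ B i j, ‖B i j‖ ^ 2 ≤ τ (g B) := by
    intro B i j
    have : τ (g B) = ∑ j, ∑ i, ‖B i j‖ ^ 2 := by
      simp only [hτ, hg, auxT, LinearMap.coe_mk, AddHom.coe_mk]
      rw [← aux_trace_fromBlocks _ (Bᴴ * B).toBlocks₁₂ (Bᴴ * B).toBlocks₂₁, fromBlocks_toBlocks]
      simp only [Matrix.trace, diag_apply, Matrix.mul_apply, conjTranspose_apply, Complex.re_sum]
      refine Finset.sum_congr rfl fun j _ => Finset.sum_congr rfl fun i _ => ?_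
      rw [Complex.star_def, ← Complex.normSq_eq_conj_mul_self, Complex.ofReal_re,
        Complex.normSq_eq_norm_sq]
    rw [this]
    refine le_trans ?_ (Finset.single_le_sum (f := fun j => ∑ i, ‖B i j‖ ^ 2)
      (fun j _ => Finset.sum_nonneg fun i _ => sq_nonneg _) (Finset.mem_univ j))
    exact Finset.single_le_sum (f := fun i => ‖B i j‖ ^ 2)
      (fun i _ => sq_nonneg _) (Finset.mem_univ i)
  set R := |τ (P, Q, H)| + 1 with hR
  have hopen : IsOpen {x | τ x < R} := isOpen_lt hτc continuous_const
  have hin : (P, Q, H) ∈ {x | τ x < R} := by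
    have := le_abs_self (τ (P, Q, H))
    simp only [Set.mem_ofPred_eq]; linarith
  have hm2 := hopen.inter_closure ⟨hin, hmem⟩
  have : ProperSpace (Matrix (Fin m ⊕ Fin m) (Fin m ⊕ Fin m) ℂ) := FiniteDimensional.proper ℂ _
  have hcomp : IsCompact (g '' Metric.closedBall 0 R) :=
    (isCompact_closedBall _ _).image hgc
  have hsub : {x | τ x < R} ∩ Set.range g ⊆ g '' Metric.closedBall 0 R := by
    rintro _ ⟨hx, ⟨B, rfl⟩⟩
    refine ⟨B, ?_, rfl⟩
    rw [mem_closedBall_zero_iff]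
    have hR1 : 1 ≤ R := by have := abs_nonneg (τ (P, Q, H)); linarith
    rw [Matrix.norm_le_iff (by linarith)]
    intro i j
    have h1 := hgτ B i j
    have h2 : τ (g B) < R := hx
    refine abs_le_of_sq_le_sq' ?_ (by linarith) |>.2
    nlinarith
  obtain ⟨B, -, hB⟩ := closure_minimal hsub hcomp.isClosed hm2
  exact ⟨B, hB⟩

end Topo

/-- Any positive linear map Φ : M₂(ℂ) → Mₘ(ℂ) admits a Kraus-type representation
Φ(A) = Σᵢ Vᵢᴴ A Vᵢ valid on all symmetric (Aᵀ = A) matrices A. -/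
theorem stmt_7 {m : ℕ}
    (Φ : Matrix (Fin 2) (Fin 2) ℂ →ₗ[ℂ] Matrix (Fin m) (Fin m) ℂ)
    (hΦ : ∀ A : Matrix (Fin 2) (Fin 2) ℂ, A.PosSemidef → (Φ A).PosSemidef) :
    ∃ (k : ℕ) (V : Fin k → Matrix (Fin 2) (Fin m) ℂ),
      ∀ A : Matrix (Fin 2) (Fin 2) ℂ, Aᵀ = A →
        Φ A = ∑ i, (V i)ᴴ * A * V i := by
  set P := Φ !![1, 0; 0, 0] with hPd
  set Q := Φ !![0, 0; 0, 1] with hQd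
  set H := Φ !![0, 1; 1, 0] with hHd
  have hA : ∀ x y z : ℂ, Φ !![x, y; y, z] = x • P + y • H + z • Q := by
    intro x y z
    rw [hPd, hQd, hHd, ← Φ.map_smul, ← Φ.map_smul, ← Φ.map_smul, ← Φ.map_add,
      ← Φ.map_add]
    congr 1
    ext i j
    fin_cases i <;> fin_cases j <;> simp
  have hreal : ∀ s t : ℝ, (Φ !![(s : ℂ) ^ 2, s * t; s * t, (t : ℂ) ^ 2]).PosSemidef := by
    intro s t
    apply hΦ
    have := posSemidef_vecMulVec_self_star ![(s : ℂ), (t : ℂ)]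
    convert this using 1
    ext i j
    fin_cases i <;> fin_cases j <;> simp [vecMulVec, pow_two, mul_comm]
  have hQ : Q.PosSemidef := by simpa using hreal 0 1
  have hP0 : P.PosSemidef := by simpa using hreal 1 0
  have hP : ∀ t : ℝ, (P + (t : ℂ) • H + ((t : ℂ) ^ 2) • Q).PosSemidef := by
    intro t
    have := hreal 1 t
    rw [hA] at this
    simpa using this
  have hH : H.IsHermitian := by
    have h1 := (hP 1).isHermitian
    have : H = (P + ((1 : ℝ) : ℂ) • H + (((1 : ℝ) : ℂ) ^ 2) • Q) - P - Q := by
      simp; abel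
    rw [this]
    exact (h1.sub hP0.isHermitian).sub hQ.isHermitian
  obtain ⟨B, hB⟩ := aux_exists hQ hH hP
  simp only [auxT, LinearMap.coe_mk, AddHom.coe_mk, Prod.mk.injEq] at hB
  obtain ⟨b1, b2, b3⟩ := hB
  let e := Fintype.equivFin (Fin m ⊕ Fin m)
  refine ⟨Fintype.card (Fin m ⊕ Fin m), fun k => Matrix.of
    ![fun a => B (e.symm k) (Sum.inl a), fun a => B (e.symm k) (Sum.inr a)], fun A hsym => ?_⟩
  have hA2 : A = !![A 0 0, A 0 1; A 0 1, A 1 1] := by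
    have h10 : A 1 0 = A 0 1 := congrFun (congrFun hsym 0) 1
    ext i j
    fin_cases i <;> fin_cases j <;> simp [h10]
  rw [hA2, hA, ← b1, ← b2, ← b3]
  ext a b
  rw [Matrix.sum_apply, Equiv.sum_comp e.symm (fun k => ((Matrix.of
    ![fun a => B k (Sum.inl a), fun a => B k (Sum.inr a)])ᴴ *
      !![A 0 0, A 0 1; A 0 1, A 1 1] * (Matrix.of
    ![fun a => B k (Sum.inl a), fun a => B k (Sum.inr a)])) a b)]
  simp only [toBlocks₁₁, toBlocks₂₂, toBlocks₁₂, toBlocks₂₁, Matrix.add_apply, Matrix.smul_apply,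
    of_apply, Matrix.mul_apply, conjTranspose_apply, smul_eq_mul, ← Finset.sum_add_distrib,
    Finset.mul_sum]
  refine Finset.sum_congr rfl fun k _ => ?_
  simp [Fin.sum_univ_two]
  ring
end

section
/- Let F(s,t) = α₁s² + α₂st + α₃t² be a quadratic form with coefficients αᵢ ∈ M_m(ℂ) and real indeterminates s, t. If F(s,t) is positive semidefinite for all real s, t, then there exist matrices β₁, β₂ ∈ ℂ^{k×m} for some k such that F(s,t) = (β₁s + β₂t)*(β₁s + β₂t) for all real s, t. -/
open Matrix
open scoped ComplexOrder

section helpers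
open scoped MatrixOrder in
lemma cal_factor {n : Type*} [Fintype n] [DecidableEq n] {M : Matrix n n ℂ} (h : M.PosSemidef) :
    ∃ G : Matrix n n ℂ, M = Gᴴ * G := by
  have := CStarAlgebra.nonneg_iff_eq_star_mul_self.mp (nonneg_iff_posSemidef.mpr h)
  simpa [star_eq_conjTranspose] using this

lemma cal_trace_mul {n : Type*} [Fintype n] [DecidableEq n] {M P : Matrix n n ℂ}
    (h : M.PosSemidef) (hP : P.PosSemidef) : 0 ≤ (trace (M * P)).re := by
  obtain ⟨G, rfl⟩ := cal_factor hP
  have := (h.mul_mul_conjTranspose_same G).trace_nonneg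
  rw [trace_mul_comm, ← Matrix.mul_assoc, trace_mul_comm] at this
  rw [← Matrix.mul_assoc, trace_mul_comm, ← Matrix.mul_assoc]
  have := (h.mul_mul_conjTranspose_same G).trace_nonneg
  exact (Complex.le_def.mp this).1

lemma cal_riesz {n : Type*} [Fintype n] [DecidableEq n] (h : Matrix n n ℂ →ₗ[ℝ] ℝ) :
    ∃ A : Matrix n n ℂ, A.IsHermitian ∧ ∀ X : Matrix n n ℂ, X.IsHermitian →
      h X = (trace (X * A)).re := by
  let g : Module.Dual ℂ (Matrix n n ℂ) := Module.Dual.extendRCLike (𝕜 := ℂ) h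
  let A : Matrix n n ℂ := Matrix.of fun j i => g (Matrix.single i j 1)
  have hA : ∀ X : Matrix n n ℂ, h X = (trace (X * A)).re := by
    intro X
    have h1 : h X = (g X).re := (Module.Dual.re_extendRCLike_apply (𝕜 := ℂ) h X).symm
    rw [h1]
    conv_lhs => rw [matrix_eq_sum_single X]
    simp only [map_sum, trace, diag, mul_apply]
    congr 1
    refine Finset.sum_congr rfl fun i _ => Finset.sum_congr rfl fun j _ => ?_
    have : single i j (X i j) = X i j • single i j (1:ℂ) := by simp
    rw [this, map_smul]; rfl
  refine ⟨(1/2 : ℂ) • (A + Aᴴ), ?_, ?_⟩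
  · simp [IsHermitian, conjTranspose_smul, add_comm]
  · intro X hX
    have h2 : trace (X * Aᴴ) = star (trace (X * A)) := by
      rw [← trace_conjTranspose, conjTranspose_mul, hX.eq, trace_mul_comm]
    rw [hA, Matrix.mul_smul, trace_smul, Matrix.mul_add, trace_add, h2]
    simp
    ring

lemma cal_pos {n : Type*} [Fintype n] [DecidableEq n] (α₁ α₂ α₃ : Matrix n n ℂ)
    (hpos : ∀ s t : ℝ,
      (((s : ℂ) ^ 2) • α₁ + ((s : ℂ) * (t : ℂ)) • α₂ + ((t : ℂ) ^ 2) • α₃).PosSemidef)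
    (A B D : Matrix n n ℂ) (hB : B.IsHermitian) (h : (fromBlocks A B B D).PosDef) :
    0 ≤ (trace (α₁ * A) + trace (α₂ * B) + trace (α₃ * D)).re := by
  have hA : A.PosDef := by
    exact h.submatrix (e := (Sum.inl : n → n ⊕ n)) Sum.inl_injective
  letI : Invertible A := hA.isUnit.invertible
  have h' : (fromBlocks A B Bᴴ D).PosSemidef := by rw [hB.eq]; exact h.posSemidef
  have hD := (PosDef.fromBlocks₁₁ B D hA).mp h'
  rw [hB.eq] at hD
  obtain ⟨R, hR⟩ := cal_factor hA.posSemidef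
  have hRu : IsUnit R := by
    have := hA.isUnit
    rw [hR] at this
    rw [isUnit_iff_isUnit_det] at this ⊢
    rw [det_mul] at this
    exact isUnit_of_mul_isUnit_right this
  have hRd : IsUnit R.det := (isUnit_iff_isUnit_det _).mp hRu
  have hRd' : IsUnit Rᴴ.det := by rw [det_conjTranspose]; exact hRd.star
  set C := (R⁻¹)ᴴ * B * R⁻¹ with hC
  have hCh : C.IsHermitian := isHermitian_conjTranspose_mul_mul _ hB
  have hBC : B = Rᴴ * C * R := by
    rw [hC, conjTranspose_nonsing_inv]
    simp only [Matrix.mul_assoc]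
    rw [nonsing_inv_mul _ hRd, Matrix.mul_one, mul_nonsing_inv_cancel_left _ _ hRd']
  have hBB : B * A⁻¹ * B = Rᴴ * (C * C) * R := by
    rw [hR, Matrix.mul_inv_rev, hBC]
    simp only [Matrix.mul_assoc]
    rw [mul_nonsing_inv_cancel_left _ _ hRd, nonsing_inv_mul_cancel_left _ _ hRd']
  obtain ⟨U, Λ, hU, hCU⟩ : ∃ (U : Matrix n n ℂ) (Λ : n → ℝ), Uᴴ * U = 1 ∧ U * Uᴴ = 1 ∧
      C = U * diagonal (fun i => (Λ i : ℂ)) * Uᴴ := by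
    refine ⟨hCh.eigenvectorUnitary, hCh.eigenvalues, ?_, ?_, ?_⟩
    · exact Unitary.coe_star_mul_self hCh.eigenvectorUnitary
    · exact Unitary.coe_mul_star_self hCh.eigenvectorUnitary
    · have := hCh.spectral_theorem
      rw [Unitary.conjStarAlgAut_apply] at this
      exact this
  obtain ⟨hU', hCU⟩ := hCU
  set L : Matrix n n ℂ := diagonal (fun i => (Λ i : ℂ)) with hL
  set W := Uᴴ * R with hW
  have hWW : Wᴴ = Rᴴ * U := by simp [hW]
  have eA : A = Wᴴ * W := by
    rw [hWW, hW, hR, Matrix.mul_assoc, ← Matrix.mul_assoc U, hU', Matrix.one_mul]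
  have eB : B = Wᴴ * L * W := by
    rw [hWW, hW, hBC, hCU]; simp only [Matrix.mul_assoc]
  have eD : B * A⁻¹ * B = Wᴴ * (L * L) * W := by
    rw [hBB, hWW, hW, hCU]; simp only [Matrix.mul_assoc]
    rw [← Matrix.mul_assoc Uᴴ U, hU, Matrix.one_mul]
  have hα₃ : α₃.PosSemidef := by simpa using hpos 0 1
  have h3 := cal_trace_mul hα₃ hD
  rw [Matrix.mul_sub, trace_sub, eD] at h3
  have key : 0 ≤ (trace (α₁ * (Wᴴ * W)) + trace (α₂ * (Wᴴ * L * W)) +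
      trace (α₃ * (Wᴴ * (L * L) * W))).re := by
    have cyc : ∀ α X : Matrix n n ℂ, trace (α * (Wᴴ * X * W)) = trace (W * α * Wᴴ * X) := by
      intro α X
      rw [← Matrix.mul_assoc, trace_mul_comm]; simp only [Matrix.mul_assoc]
    have c1 := cyc α₁ 1
    rw [Matrix.mul_one, Matrix.mul_one] at c1
    rw [c1, cyc, cyc, hL, diagonal_mul_diagonal]
    simp only [trace, diag, mul_diagonal]
    rw [← Finset.sum_add_distrib, ← Finset.sum_add_distrib, Complex.re_sum]
    refine Finset.sum_nonneg fun i _ => ?_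
    have := ((hpos 1 (Λ i)).mul_mul_conjTranspose_same W).diag_nonneg (i := i)
    have := (Complex.le_def.mp this).1
    simp only [Matrix.mul_add, Matrix.add_mul, Matrix.mul_smul, Matrix.smul_mul,
      Matrix.add_apply, Matrix.smul_apply, smul_eq_mul] at this
    refine le_of_le_of_eq this (congrArg Complex.re ?_)
    push_cast; ring
  rw [← eA, ← eB] at key
  simp only [Complex.add_re, Complex.sub_re] at *
  linarith

def calT (n : Type*) [Fintype n] : Set (Matrix n n ℂ) := {M | M.PosSemidef ∧ trace M = 1}

lemma calT_convex (n : Type*) [Fintype n] : Convex ℝ (calT n) := by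
  rintro x ⟨hx, hx1⟩ y ⟨hy, hy1⟩ a b ha hb hab
  refine ⟨(hx.smul ha).add (hy.smul hb), ?_⟩
  rw [trace_add, trace_smul, trace_smul, hx1, hy1]
  simp [← Complex.ofReal_add, hab]

lemma calT_compact (n : Type*) [Fintype n] [DecidableEq n] : IsCompact (calT n) := by
  have hS : IsCompact {G : Matrix n n ℂ | trace (Gᴴ * G) = 1} := by
    have hK : IsCompact (Set.univ.pi fun _ : n => Set.univ.pi fun _ : n =>
        Metric.closedBall (0:ℂ) 1) :=
      isCompact_univ_pi fun _ => isCompact_univ_pi fun _ => isCompact_closedBall _ _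
    refine IsCompact.of_isClosed_subset (X := Matrix n n ℂ) hK ?_ ?_
    · exact isClosed_eq (by fun_prop) continuous_const
    · intro G hG i _ j _
      have h1 : ∑ j, ∑ i, ‖G i j‖ ^ 2 = (1:ℝ) := by
        have : (trace (Gᴴ * G)) = ((∑ j, ∑ i, ‖G i j‖ ^ 2 : ℝ) : ℂ) := by
          simp [trace, mul_apply, Complex.conj_mul']
        rw [Set.mem_setOf_eq, this] at hG
        exact_mod_cast hG
      have h2 : ‖G i j‖ ^ 2 ≤ 1 := by
        rw [← h1]
        refine le_trans ?_ (Finset.single_le_sum (f := fun j => ∑ i, ‖G i j‖ ^ 2)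
          (fun _ _ => by positivity) (Finset.mem_univ j))
        exact Finset.single_le_sum (f := fun i => ‖G i j‖ ^ 2)
          (fun _ _ => by positivity) (Finset.mem_univ i)
      simp only [Metric.mem_closedBall, dist_zero_right]
      exact (sq_le_one_iff₀ (norm_nonneg _)).mp h2
  have : calT n = (fun G : Matrix n n ℂ => Gᴴ * G) '' {G | trace (Gᴴ * G) = 1} := by
    ext M
    constructor
    · rintro ⟨h, h1⟩
      obtain ⟨G, rfl⟩ := cal_factor h
      exact ⟨G, h1, rfl⟩
    · rintro ⟨G, h1, rfl⟩
      exact ⟨posSemidef_conjTranspose_mul_self G, h1⟩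
  rw [this]
  exact hS.image (by fun_prop)

def calL (n : Type*) : Matrix (n ⊕ n) (n ⊕ n) ℂ →ₗ[ℝ] Matrix n n ℂ × Matrix n n ℂ × Matrix n n ℂ where
  toFun M := (M.toBlocks₁₁, M.toBlocks₁₂ + M.toBlocks₂₁, M.toBlocks₂₂)
  map_add' x y := by
    refine Prod.ext rfl (Prod.ext ?_ rfl)
    ext i j
    simp [toBlocks₁₂, toBlocks₂₁]; ring
  map_smul' c x := by
    refine Prod.ext rfl (Prod.ext ?_ rfl)
    ext i j
    simp [toBlocks₁₂, toBlocks₂₁]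

lemma calL_cont (n : Type*) : Continuous (calL n) := by
  change Continuous fun M : Matrix (n ⊕ n) (n ⊕ n) ℂ =>
    (M.toBlocks₁₁, M.toBlocks₁₂ + M.toBlocks₂₁, M.toBlocks₂₂)
  unfold toBlocks₁₁ toBlocks₁₂ toBlocks₂₁ toBlocks₂₂
  fun_prop

lemma cal_main {n : Type*} [Fintype n] [DecidableEq n] (α₁ α₂ α₃ : Matrix n n ℂ)
    (hpos : ∀ s t : ℝ,
      (((s : ℂ) ^ 2) • α₁ + ((s : ℂ) * (t : ℂ)) • α₂ + ((t : ℂ) ^ 2) • α₃).PosSemidef)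
    (htr : trace α₁ + trace α₃ = 1) :
    ∃ M : Matrix (n ⊕ n) (n ⊕ n) ℂ, M.PosSemidef ∧ calL n M = (α₁, α₂, α₃) := by
  by_contra hcon
  haveI : LocallyConvexSpace ℝ (Matrix n n ℂ) :=
    inferInstanceAs (LocallyConvexSpace ℝ (n → n → ℂ))
  have hnot : (α₁, α₂, α₃) ∉ calL n '' calT (n ⊕ n) := by
    rintro ⟨M, hM, h⟩
    exact hcon ⟨M, hM.1, h⟩
  obtain ⟨f, u, hfu, hf⟩ := geometric_hahn_banach_point_closed
    ((calT_convex (n ⊕ n)).linear_image (calL n))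
    ((calT_compact (n ⊕ n)).image (calL_cont n)).isClosed hnot
  let E := Matrix n n ℂ × Matrix n n ℂ × Matrix n n ℂ
  obtain ⟨A₀, hA₀, hA⟩ := cal_riesz (f.toLinearMap ∘ₗ LinearMap.inl ℝ (Matrix n n ℂ) (Matrix n n ℂ × Matrix n n ℂ))
  obtain ⟨B, hB₀, hB⟩ := cal_riesz (f.toLinearMap ∘ₗ LinearMap.inr ℝ (Matrix n n ℂ) (Matrix n n ℂ × Matrix n n ℂ) ∘ₗ LinearMap.inl ℝ (Matrix n n ℂ) (Matrix n n ℂ))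
  obtain ⟨D₀, hD₀, hD⟩ := cal_riesz (f.toLinearMap ∘ₗ LinearMap.inr ℝ (Matrix n n ℂ) (Matrix n n ℂ × Matrix n n ℂ) ∘ₗ LinearMap.inr ℝ (Matrix n n ℂ) (Matrix n n ℂ))
  have hfrep : ∀ X Y Z : Matrix n n ℂ, X.IsHermitian → Y.IsHermitian → Z.IsHermitian →
      f (X, Y, Z) = (trace (X * A₀) + trace (Y * B) + trace (Z * D₀)).re := by
    intro X Y Z hX hY hZ
    have e : (X, Y, Z) = (X, (0 : Matrix n n ℂ × Matrix n n ℂ)) + ((0, (Y, 0)) + (0, (0, Z))) := by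
      simp
    rw [e, map_add, map_add, Complex.add_re, Complex.add_re, ← hA X hX, ← hB Y hY, ← hD Z hZ, add_assoc]
    rfl
  set A := A₀ - (u : ℂ) • (1 : Matrix n n ℂ) with hAdef
  set D := D₀ - (u : ℂ) • (1 : Matrix n n ℂ) with hDdef
  have hone : ((u : ℂ) • (1 : Matrix n n ℂ)).IsHermitian := by
    simp [IsHermitian, conjTranspose_smul]
  have hg : ∀ X Y Z : Matrix n n ℂ, X.IsHermitian → Y.IsHermitian → Z.IsHermitian →
      trace X + trace Z = 1 →
      (trace (X * A) + trace (Y * B) + trace (Z * D)).re = f (X, Y, Z) - u := by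
    intro X Y Z hX hY hZ h1
    rw [hfrep X Y Z hX hY hZ, hAdef, hDdef]
    simp only [Matrix.mul_sub, trace_sub, Matrix.mul_smul, Matrix.mul_one, trace_smul, smul_eq_mul]
    have : (u:ℂ) = u * (trace X + trace Z) := by rw [h1, mul_one]
    have := congrArg Complex.re this
    simp only [Complex.ofReal_re, mul_add, Complex.add_re, Complex.sub_re] at *
    linarith
  have hPD : (fromBlocks A B B D).PosDef := by
    have hH : (fromBlocks A B B D).IsHermitian :=
      IsHermitian.fromBlocks (hA₀.sub hone) hB₀ (hD₀.sub hone)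
    have hpr : ∀ M ∈ calT (n ⊕ n), 0 < (trace (M * fromBlocks A B B D)).re := by
      intro M hM
      have h1 := hf _ ⟨M, hM, rfl⟩
      have hMH := hM.1.isHermitian
      have hM1 := hM.2
      rw [← fromBlocks_toBlocks M] at hMH hM1 ⊢
      rw [isHermitian_fromBlocks_iff] at hMH
      obtain ⟨a, b, c, d⟩ := hMH
      have hb : (M.toBlocks₁₂ + M.toBlocks₂₁).IsHermitian := by
        rw [IsHermitian, conjTranspose_add, b, c, add_comm]
      have := hg M.toBlocks₁₁ (M.toBlocks₁₂ + M.toBlocks₂₁) M.toBlocks₂₂ a hb d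
        (by simpa [trace] using hM1)
      rw [fromBlocks_multiply]
      have h2 : trace (fromBlocks (M.toBlocks₁₁ * A + M.toBlocks₁₂ * B) (M.toBlocks₁₁ * B + M.toBlocks₁₂ * D)
          (M.toBlocks₂₁ * A + M.toBlocks₂₂ * B) (M.toBlocks₂₁ * B + M.toBlocks₂₂ * D)) =
          trace (M.toBlocks₁₁ * A + M.toBlocks₁₂ * B) + trace (M.toBlocks₂₁ * B + M.toBlocks₂₂ * D) := by
        simp [trace]
      rw [h2]
      rw [Matrix.add_mul] at this
      simp only [trace_add, Complex.add_re] at this ⊢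
      have h3 : u < f (M.toBlocks₁₁, M.toBlocks₁₂ + M.toBlocks₂₁, M.toBlocks₂₂) := h1
      linarith
    refine PosDef.of_dotProduct_mulVec_pos hH fun x hx => ?_
    have hr : 0 < star x ⬝ᵥ x := dotProduct_star_self_pos_iff.mpr hx
    obtain ⟨r, hr0, hr1⟩ : ∃ r : ℝ, 0 < r ∧ star x ⬝ᵥ x = r := by
      obtain ⟨h1, h2⟩ := Complex.lt_def.mp hr
      exact ⟨(star x ⬝ᵥ x).re, h1, Complex.ext rfl (by simpa using h2.symm)⟩
    have hm : (r⁻¹ : ℝ) • vecMulVec x (star x) ∈ calT (n ⊕ n) := by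
      refine ⟨(posSemidef_vecMulVec_self_star x).smul (by positivity), ?_⟩
      rw [trace_smul, trace_vecMulVec, dotProduct_comm, hr1]
      simp [hr0.ne']
    have h1 := hpr _ hm
    rw [smul_mul, trace_smul, vecMulVec_mul, trace_vecMulVec, dotProduct_comm,
      ← dotProduct_mulVec, Complex.smul_re, smul_eq_mul] at h1
    have h2 := pos_of_mul_pos_right h1 (by positivity)
    rw [Complex.lt_def]
    refine ⟨h2, ?_⟩
    have := hH.im_star_dotProduct_mulVec_self x
    simpa using this.symm
  have hα₁ : α₁.IsHermitian := by simpa using (hpos 1 0).isHermitian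
  have hα₃ : α₃.IsHermitian := by simpa using (hpos 0 1).isHermitian
  have hα₂ : α₂.IsHermitian := by
    have := ((hpos 1 1).isHermitian.sub hα₁).sub hα₃
    have e : α₁ + α₂ + α₃ - α₁ - α₃ = α₂ := by abel
    simpa [e] using this
  have h1 := cal_pos α₁ α₂ α₃ hpos A B D hB₀ hPD
  rw [hg _ _ _ hα₁ hα₂ hα₃ htr] at h1
  linarith

lemma cal_exists {n : Type*} [Fintype n] [DecidableEq n] (α₁ α₂ α₃ : Matrix n n ℂ)
    (hpos : ∀ s t : ℝ,
      (((s : ℂ) ^ 2) • α₁ + ((s : ℂ) * (t : ℂ)) • α₂ + ((t : ℂ) ^ 2) • α₃).PosSemidef) :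
    ∃ M : Matrix (n ⊕ n) (n ⊕ n) ℂ, M.PosSemidef ∧ calL n M = (α₁, α₂, α₃) := by
  have hα₁ : α₁.PosSemidef := by simpa using hpos 1 0
  have hα₃ : α₃.PosSemidef := by simpa using hpos 0 1
  have t1 := hα₁.trace_nonneg
  have t3 := hα₃.trace_nonneg
  by_cases h0 : trace α₁ + trace α₃ = 0
  · obtain ⟨z1, z3⟩ := (add_eq_zero_iff_of_nonneg t1 t3).mp h0
    rw [hα₁.trace_eq_zero_iff] at z1
    rw [hα₃.trace_eq_zero_iff] at z3
    subst z1 z3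
    have p1 : α₂.PosSemidef := by simpa using hpos 1 1
    have p2 : (-α₂).PosSemidef := by simpa using hpos 1 (-1)
    have : trace α₂ = 0 := by
      have a := p1.trace_nonneg
      have b := p2.trace_nonneg
      rw [trace_neg] at b
      exact le_antisymm (neg_nonneg.mp b) a
    rw [p1.trace_eq_zero_iff] at this
    subst this
    exact ⟨0, PosSemidef.zero, map_zero _⟩
  · obtain ⟨r, hr0, hr1⟩ : ∃ r : ℝ, 0 < r ∧ trace α₁ + trace α₃ = r := by
      have hr := lt_of_le_of_ne (add_nonneg t1 t3) (Ne.symm h0)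
      obtain ⟨h1, h2⟩ := Complex.lt_def.mp hr
      exact ⟨(trace α₁ + trace α₃).re, h1, Complex.ext rfl (by simpa using h2.symm)⟩
    obtain ⟨M, hM, hL⟩ := cal_main ((r⁻¹ : ℝ) • α₁) ((r⁻¹ : ℝ) • α₂) ((r⁻¹ : ℝ) • α₃)
      (by
        intro s t
        have := (hpos s t).smul (show (0:ℝ) ≤ r⁻¹ by positivity)
        simpa only [smul_add, smul_comm (r⁻¹ : ℝ)] using this)
      (by
        rw [trace_smul, trace_smul, ← smul_add, hr1]
        simp [hr0.ne'])
    refine ⟨r • M, hM.smul hr0.le, ?_⟩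
    rw [map_smul, hL]
    simp [hr0.ne']
end helpers

/-- Calderon's theorem: a matrix-valued quadratic form F(s,t) = α₁s² + α₂st + α₃t²
which is positive semidefinite for all real s,t factors as
F(s,t) = (β₁s + β₂t)ᴴ(β₁s + β₂t). -/
theorem stmt_8 {m : ℕ} (α₁ α₂ α₃ : Matrix (Fin m) (Fin m) ℂ)
    (hpos : ∀ s t : ℝ,
      (((s : ℂ) ^ 2) • α₁ + ((s : ℂ) * (t : ℂ)) • α₂ + ((t : ℂ) ^ 2) • α₃).PosSemidef) :
    ∃ (k : ℕ) (β₁ β₂ : Matrix (Fin k) (Fin m) ℂ),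
      ∀ s t : ℝ,
        ((s : ℂ) ^ 2) • α₁ + ((s : ℂ) * (t : ℂ)) • α₂ + ((t : ℂ) ^ 2) • α₃ =
          ((s : ℂ) • β₁ + (t : ℂ) • β₂)ᴴ * ((s : ℂ) • β₁ + (t : ℂ) • β₂) := by
  obtain ⟨M, hM, hL⟩ := cal_exists α₁ α₂ α₃ hpos
  obtain ⟨G, rfl⟩ := cal_factor hM
  let e : Fin (m + m) ≃ Fin m ⊕ Fin m := finSumFinEquiv.symm
  let β₁ : Matrix (Fin (m + m)) (Fin m) ℂ := Matrix.of fun i j => G (e i) (Sum.inl j)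
  let β₂ : Matrix (Fin (m + m)) (Fin m) ℂ := Matrix.of fun i j => G (e i) (Sum.inr j)
  have key : ∀ p q : Fin m ⊕ Fin m, (Gᴴ * G) p q = ∑ i, star (G (e i) p) * G (e i) q := by
    intro p q
    rw [mul_apply, ← Equiv.sum_comp e]
    rfl
  have e1 : α₁ = β₁ᴴ * β₁ := by
    refine (congrArg Prod.fst hL).symm.trans ?_; ext i j; exact key _ _
  have e2 : α₂ = β₁ᴴ * β₂ + β₂ᴴ * β₁ := by
    refine (congrArg (fun x => x.2.1) hL).symm.trans ?_; ext i j
    exact congrArg₂ (· + ·) (key _ _) (key _ _)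
  have e3 : α₃ = β₂ᴴ * β₂ := by
    refine (congrArg (fun x => x.2.2) hL).symm.trans ?_; ext i j; exact key _ _
  refine ⟨m + m, β₁, β₂, fun s t => ?_⟩
  rw [e1, e2, e3]
  simp only [conjTranspose_add, conjTranspose_smul, Matrix.add_mul, Matrix.mul_add,
    Matrix.smul_mul, Matrix.mul_smul, Complex.star_def, Complex.conj_ofReal]
  module
end

section
/- Let Φ : M₃(ℂ) → Mₘ(ℂ) be positive. Then there exist matrices Vᵢ ∈ ℂ^{3×m} such that Φ(A) = Σᵢ Vᵢ* A Vᵢ for all matrices A of the form A = [[a,a,b],[a,a,b],[b,b,c]] with a, b, c ∈ ℂ. -/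
open Matrix
open scoped ComplexOrder

section aux
variable {n : Type*} [Fintype n] [DecidableEq n]

open scoped MatrixOrder in
lemma aux_factor_s11 {A : Matrix n n ℂ} (hA : A.PosSemidef) : ∃ S : Matrix n n ℂ, A = Sᴴ * S :=
  CStarAlgebra.nonneg_iff_eq_star_mul_self.mp hA.nonneg

lemma aux_diag {A : Matrix n n ℂ} (hA : A.IsHermitian) :
    ∃ (U : Matrix n n ℂ) (d : n → ℝ), U * Uᴴ = 1 ∧ Uᴴ * U = 1 ∧
      A = U * diagonal (fun i => (d i : ℂ)) * Uᴴ := by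
  refine ⟨hA.eigenvectorUnitary, hA.eigenvalues, ?_, ?_, ?_⟩
  · exact Unitary.coe_mul_star_self hA.eigenvectorUnitary
  · exact Unitary.coe_star_mul_self hA.eigenvectorUnitary
  · have h := hA.spectral_theorem
    rw [Unitary.conjStarAlgAut_apply] at h
    exact h

lemma aux_trace {R C : Matrix n n ℂ} (hR : R.PosSemidef) (hC : C.PosSemidef) :
    0 ≤ (R * C).trace := by
  obtain ⟨L, rfl⟩ := aux_factor_s11 hR
  rw [Matrix.mul_assoc, trace_mul_comm]
  exact (hC.mul_mul_conjTranspose_same L).trace_nonneg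

lemma aux_shift (H : Matrix n n ℂ) (hH : H.IsHermitian) :
    ∃ c : ℝ, 0 ≤ c ∧ ((c : ℂ) • (1 : Matrix n n ℂ) + H).PosSemidef := by
  obtain ⟨U, d, h1, h2, h3⟩ := aux_diag hH
  refine ⟨∑ i, |d i|, Finset.sum_nonneg fun _ _ => abs_nonneg _, ?_⟩
  have : (((∑ i, |d i| : ℝ) : ℂ) • (1 : Matrix n n ℂ) + H)
      = U * diagonal (fun i => (((∑ j, |d j|) + d i : ℝ) : ℂ)) * Uᴴ := by
    have e : diagonal (fun i => (((∑ j, |d j|) + d i : ℝ) : ℂ))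
        = ((∑ i, |d i| : ℝ) : ℂ) • (1 : Matrix n n ℂ) + diagonal (fun i => (d i : ℂ)) := by
      rw [smul_one_eq_diagonal, diagonal_add]
      congr 1
      funext i
      push_cast
      rfl
    rw [e, Matrix.mul_add, Matrix.add_mul, ← h3, Matrix.mul_smul, Matrix.smul_mul,
      Matrix.mul_one, h1]
  rw [this]
  apply PosSemidef.mul_mul_conjTranspose_same
  apply PosSemidef.diagonal
  intro i
  have h := Finset.single_le_sum (f := fun j => |d j|) (fun j _ => abs_nonneg _)
    (Finset.mem_univ i)
  have h' := neg_abs_le (d i)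
  simp only [Pi.zero_apply]
  exact_mod_cast (by linarith : 0 ≤ (∑ j, |d j|) + d i)

/-- the trace pairing -/
noncomputable def auxF (P Q R : Matrix n n ℂ) : Matrix (n ⊕ n) (n ⊕ n) ℂ →ₗ[ℂ] ℂ where
  toFun M := (P * M.toBlocks₁₁).trace + (Q * M.toBlocks₁₂).trace + (R * M.toBlocks₂₂).trace
  map_add' M N := by
    have h1 : (M + N).toBlocks₁₁ = M.toBlocks₁₁ + N.toBlocks₁₁ := rfl
    have h2 : (M + N).toBlocks₁₂ = M.toBlocks₁₂ + N.toBlocks₁₂ := rfl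
    have h3 : (M + N).toBlocks₂₂ = M.toBlocks₂₂ + N.toBlocks₂₂ := rfl
    simp only [h1, h2, h3, Matrix.mul_add, trace_add]
    ring
  map_smul' c M := by
    have h1 : (c • M).toBlocks₁₁ = c • M.toBlocks₁₁ := rfl
    have h2 : (c • M).toBlocks₁₂ = c • M.toBlocks₁₂ := rfl
    have h3 : (c • M).toBlocks₂₂ = c • M.toBlocks₂₂ := rfl
    simp only [h1, h2, h3, Matrix.mul_smul, trace_smul, smul_eq_mul, RingHom.id_apply]
    ring

lemma auxF_fromBlocks (P Q R A B B' C : Matrix n n ℂ) :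
    auxF P Q R (fromBlocks A B B' C) = (P * A).trace + (Q * B).trace + (R * C).trace := by
  simp [auxF]

lemma aux_pos_def (P Q R : Matrix n n ℂ)
    (h : ∀ t : ℝ, (P + (t : ℂ) • Q + ((t : ℂ) ^ 2) • R).PosSemidef) (hR : R.PosSemidef)
    (A B C : Matrix n n ℂ) (hA : A.PosDef) (hB : B.IsHermitian)
    (hM : (fromBlocks A B B C).PosSemidef) :
    0 ≤ (P * A).trace + (Q * B).trace + (R * C).trace := by
  have hinv := hA.isUnit.invertible
  have hS0 : (C - Bᴴ * A⁻¹ * B).PosSemidef := by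
    rw [← Matrix.PosDef.fromBlocks₁₁ B C hA, hB.eq]
    exact hM
  rw [hB.eq] at hS0
  obtain ⟨S, hS⟩ := aux_factor_s11 hA.posSemidef
  have hSu : IsUnit S := by
    have := hA.isUnit
    rw [hS] at this
    rw [Matrix.isUnit_iff_isUnit_det] at this ⊢
    rw [det_mul] at this
    exact isUnit_of_mul_isUnit_right this
  have hSd : IsUnit S.det := (Matrix.isUnit_iff_isUnit_det S).mp hSu
  have hSd' : IsUnit Sᴴ.det := by rw [det_conjTranspose]; exact hSd.star
  obtain ⟨U, d, h1, h2, h3⟩ := aux_diag (A := (S⁻¹)ᴴ * B * S⁻¹) (by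
    rw [IsHermitian]
    simp [conjTranspose_mul, hB.eq, Matrix.mul_assoc])
  set D := diagonal (fun i => (d i : ℂ)) with hD
  have hBD : B = Sᴴ * (U * D * Uᴴ) * S := by
    rw [← h3, conjTranspose_nonsing_inv]
    simp only [Matrix.mul_assoc]
    rw [nonsing_inv_mul _ hSd, Matrix.mul_one, mul_nonsing_inv_cancel_left _ _ hSd']
  have hAi : A⁻¹ = S⁻¹ * (Sᴴ)⁻¹ := by rw [hS, Matrix.mul_inv_rev]
  have hBAB : B * A⁻¹ * B = Sᴴ * (U * (D * D) * Uᴴ) * S := by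
    rw [hAi, hBD]
    simp only [Matrix.mul_assoc]
    rw [mul_nonsing_inv_cancel_left _ _ hSd, nonsing_inv_mul_cancel_left _ _ hSd',
      ← Matrix.mul_assoc Uᴴ U, h2, Matrix.one_mul]
  have hC := aux_trace hR hS0
  rw [Matrix.mul_sub, trace_sub, hBAB] at hC
  have key : 0 ≤ (P * A).trace + (Q * B).trace + (R * (Sᴴ * (U * (D * D) * Uᴴ) * S)).trace := by
    set W := Sᴴ * U with hW
    have hWH : Wᴴ = Uᴴ * S := by simp [hW]
    have e1 : P * A = P * (W * Wᴴ) := by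
      rw [hS, hWH, hW, Matrix.mul_assoc Sᴴ U, ← Matrix.mul_assoc U, h1, Matrix.one_mul]
    have e2 : Q * B = Q * (W * D * Wᴴ) := by
      rw [hBD, hWH, hW]; simp only [Matrix.mul_assoc]
    have e3 : R * (Sᴴ * (U * (D * D) * Uᴴ) * S) = R * (W * (D * D) * Wᴴ) := by
      rw [hWH, hW]; simp only [Matrix.mul_assoc]
    have t1 : (P * (W * Wᴴ)).trace = (Wᴴ * P * W).trace := by
      rw [← Matrix.mul_assoc, trace_mul_comm, Matrix.mul_assoc]
    have t2 : (Q * (W * D * Wᴴ)).trace = (Wᴴ * Q * W * D).trace := by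
      rw [← Matrix.mul_assoc, trace_mul_comm]; simp only [Matrix.mul_assoc]
    have t3 : (R * (W * (D * D) * Wᴴ)).trace = (Wᴴ * R * W * (D * D)).trace := by
      rw [← Matrix.mul_assoc, trace_mul_comm]; simp only [Matrix.mul_assoc]
    rw [e1, e2, e3, t1, t2, t3, hD, diagonal_mul_diagonal]
    simp only [trace, diag, mul_diagonal, ← Finset.sum_add_distrib]
    refine Finset.sum_nonneg fun j _ => ?_
    have hj := ((h (d j)).conjTranspose_mul_mul_same W).diag_nonneg (i := j)
    simp only [Matrix.mul_add, Matrix.add_mul, Matrix.mul_smul, Matrix.smul_mul,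
      Matrix.add_apply, Matrix.smul_apply, smul_eq_mul] at hj
    convert hj using 1
    ring
  have := add_nonneg key hC
  convert this using 1
  ring

lemma aux_pos (P Q R : Matrix n n ℂ)
    (h : ∀ t : ℝ, (P + (t : ℂ) • Q + ((t : ℂ) ^ 2) • R).PosSemidef) (hR : R.PosSemidef)
    (A B C : Matrix n n ℂ) (hM : (fromBlocks A B B C).PosSemidef) :
    0 ≤ ((P * A).trace + (Q * B).trace + (R * C).trace).re := by
  have hH := hM.isHermitian
  rw [isHermitian_fromBlocks_iff] at hH
  have hA : A.PosSemidef := hM.submatrix Sum.inl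
  have hε : ∀ ε : ℝ, 0 < ε → 0 ≤ ((P * A).trace + (Q * B).trace + (R * C).trace).re
      + ε * (P.trace + R.trace).re := by
    intro ε hε
    have hε' : (0 : ℂ) < (ε : ℂ) := by exact_mod_cast hε
    have h1 := aux_pos_def P Q R h hR (A + (ε : ℂ) • 1) B (C + (ε : ℂ) • 1)
      (PosDef.posSemidef_add hA (PosDef.one.smul hε')) hH.2.1 (by
        have := hM.add ((PosSemidef.one (n := n ⊕ n) (R := ℂ)).smul hε'.le)
        rw [← fromBlocks_one, fromBlocks_smul, fromBlocks_add] at this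
        simpa using this)
    have h2 := (Complex.le_def.mp h1).1
    simp only [Matrix.mul_add, Matrix.mul_smul, trace_add, trace_smul, Matrix.mul_one,
      Complex.add_re, smul_eq_mul, Complex.re_ofReal_mul, Complex.zero_re] at h2 ⊢
    linarith
  by_contra hneg
  push Not at hneg
  set x := ((P * A).trace + (Q * B).trace + (R * C).trace).re
  set y := (P.trace + R.trace).re
  have hy : 0 < |y| + 1 := by positivity
  have h3 := hε (-x / (2 * (|y| + 1))) (by apply div_pos <;> linarith)
  have h4 : -x / (2 * (|y| + 1)) * y ≤ -x / 2 := by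
    have : -x / (2 * (|y| + 1)) * y = (-x / 2) * (y / (|y| + 1)) := by field_simp
    rw [this]
    have h5 : y / (|y| + 1) ≤ 1 := by
      rw [div_le_one hy]; linarith [le_abs_self y]
    nlinarith
  linarith

/-- the cone of matrices with positive semidefinite Hermitian part -/
def auxCone (N : Type*) [Fintype N] : PointedCone ℝ (Matrix N N ℂ) where
  carrier := {M | (M + Mᴴ).PosSemidef}
  add_mem' := by
    intro a b ha hb
    simp only [Set.mem_ofPred_eq] at *
    have := ha.add hb
    rw [conjTranspose_add]
    convert this using 1
    abel
  zero_mem' := by simpa using PosSemidef.zero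
  smul_mem' := by
    intro c x hx
    simp only [Set.mem_ofPred_eq] at *
    have hc : (0 : ℂ) ≤ ((c : ℝ) : ℂ) := by exact_mod_cast c.2
    have := hx.smul hc
    convert this using 1
    ext i j
    have hs : ∀ z : ℂ, c • z = ((c : ℝ) : ℂ) * z := fun z => Complex.real_smul
    simp [hs, mul_add]

lemma mem_auxCone {N : Type*} [Fintype N] (M : Matrix N N ℂ) :
    M ∈ auxCone N ↔ (M + Mᴴ).PosSemidef := Iff.rfl

/-- matrices with equal off-diagonal blocks -/
def auxDom (n : Type*) : Submodule ℝ (Matrix (n ⊕ n) (n ⊕ n) ℂ) where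
  carrier := {M | ∀ i j, M (Sum.inl i) (Sum.inr j) = M (Sum.inr i) (Sum.inl j)}
  add_mem' := by
    intro a b ha hb i j
    simp [ha i j, hb i j]
  zero_mem' := by intro i j; rfl
  smul_mem' := by
    intro c x hx i j
    simp [hx i j]

lemma aux_ext (P Q R : Matrix n n ℂ)
    (h : ∀ t : ℝ, (P + (t : ℂ) • Q + ((t : ℂ) ^ 2) • R).PosSemidef) (hP : P.PosSemidef)
    (hQ : Q.IsHermitian) (hR : R.PosSemidef) :
    ∃ g : Matrix (n ⊕ n) (n ⊕ n) ℂ →ₗ[ℝ] ℝ,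
      (∀ A B C, g (fromBlocks A B B C) = ((P * A).trace + (Q * B).trace + (R * C).trace).re) ∧
      ∀ M, (M + Mᴴ).PosSemidef → 0 ≤ g M := by
  let f0 : Matrix (n ⊕ n) (n ⊕ n) ℂ →ₗ[ℝ] ℝ :=
    Complex.reLm ∘ₗ ((auxF P Q R).restrictScalars ℝ)
  have hf0 : ∀ M, f0 M = (auxF P Q R M).re := fun M => rfl
  let f : Matrix (n ⊕ n) (n ⊕ n) ℂ →ₗ.[ℝ] ℝ := ⟨auxDom n, f0.domRestrict (auxDom n)⟩
  obtain ⟨g, hg1, hg2⟩ := riesz_extension (auxCone (n ⊕ n)) f (by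
    rintro ⟨M, hM⟩ hMc
    change 0 ≤ f0 M
    rw [hf0]
    have hM' : M.toBlocks₂₁ = M.toBlocks₁₂ := by
      ext i j; exact (hM i j).symm
    have hb := fromBlocks_toBlocks M
    rw [hM'] at hb
    change (M + Mᴴ).PosSemidef at hMc
    generalize M.toBlocks₁₁ = A at *
    generalize M.toBlocks₁₂ = B at *
    generalize M.toBlocks₂₂ = C at *
    rw [← hb, fromBlocks_conjTranspose, fromBlocks_add] at hMc
    have := aux_pos P Q R h hR _ _ _ hMc
    rw [← hb, auxF_fromBlocks]
    have ht : ∀ X Y : Matrix n n ℂ, X.IsHermitian → ((X * Yᴴ).trace).re = ((X * Y).trace).re := by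
      intro X Y hX
      have : (X * Yᴴ).trace = star ((X * Y).trace) := by
        rw [← trace_conjTranspose, conjTranspose_mul, hX.eq, trace_mul_comm]
      rw [this]
      simp
    simp only [Matrix.mul_add, trace_add, Complex.add_re, ht P A hP.isHermitian, ht Q B hQ,
      ht R C hR.isHermitian] at this ⊢
    linarith) (by
    intro y
    obtain ⟨c, hc, hy⟩ := aux_shift (y + yᴴ) (by
      rw [IsHermitian, conjTranspose_add, conjTranspose_conjTranspose, add_comm])
    refine ⟨⟨(c : ℂ) • 1, ?_⟩, ?_⟩
    · intro i j
      simp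
    · change ((c : ℂ) • 1 + y + ((c : ℂ) • 1 + y)ᴴ).PosSemidef
      have h1 := hy.add ((PosSemidef.one (n := n ⊕ n) (R := ℂ)).smul
        (show (0 : ℂ) ≤ (c : ℂ) by exact_mod_cast hc))
      convert h1 using 1
      rw [conjTranspose_add, conjTranspose_smul, conjTranspose_one]
      simp only [RCLike.star_def, Complex.conj_ofReal]
      abel)
  refine ⟨g, ?_, hg2⟩
  intro A B C
  have := hg1 ⟨fromBlocks A B B C, by intro i j; rfl⟩
  rw [this]
  change f0 (fromBlocks A B B C) = _
  rw [hf0, auxF_fromBlocks]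

lemma aux_choi {N : Type*} [Fintype N] [DecidableEq N] (g : Matrix N N ℂ →ₗ[ℝ] ℝ)
    (hg : ∀ M, (M + Mᴴ).PosSemidef → 0 ≤ g M) :
    ∃ G : Matrix N N ℂ, G.PosSemidef ∧
      ∀ M, (G * M).trace = (g M : ℂ) - Complex.I * (g (Complex.I • M) : ℂ) := by
  have hanti : ∀ M : Matrix N N ℂ, M + Mᴴ = 0 → g M = 0 := by
    intro M hM
    apply le_antisymm
    · have := hg (-M) (by
        rw [conjTranspose_neg, ← neg_add, hM, neg_zero]; exact PosSemidef.zero)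
      rw [map_neg] at this
      linarith
    · exact hg M (by rw [hM]; exact PosSemidef.zero)
  let h0 : Matrix N N ℂ →ₗ[ℂ] ℂ := Module.Dual.extendRCLike g
  have hh0 : ∀ M, h0 M = (g M : ℂ) - Complex.I * (g (Complex.I • M) : ℂ) := by
    intro M
    simp [h0, Module.Dual.extendRCLike_apply]
  let G : Matrix N N ℂ := of fun i j => h0 (single j i 1)
  have hG : ∀ M, (G * M).trace = h0 M := by
    intro M
    conv_rhs => rw [matrix_eq_sum_single M]
    simp only [map_sum, trace, diag, mul_apply]
    rw [Finset.sum_comm]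
    refine Finset.sum_congr rfl fun i _ => Finset.sum_congr rfl fun j _ => ?_
    have : single i j (M i j) = M i j • single i j (1 : ℂ) := by simp
    rw [this, map_smul, smul_eq_mul, mul_comm]
    rfl
  have hstar : ∀ M, h0 Mᴴ = star (h0 M) := by
    intro M
    have e1 : g Mᴴ = g M := by
      have := hanti (Mᴴ - M) (by simp)
      rw [map_sub] at this
      linarith
    have e2 : g (Complex.I • Mᴴ) = - g (Complex.I • M) := by
      have := hanti (Complex.I • Mᴴ + Complex.I • M) (by
        simp [conjTranspose_smul])
      rw [map_add] at this
      linarith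
    rw [hh0, hh0, e1, e2]
    simp
  refine ⟨G, ?_, fun M => by rw [hG, hh0]⟩
  refine PosSemidef.of_dotProduct_mulVec_nonneg ?_ ?_
  · ext i j
    simp only [conjTranspose_apply, G, of_apply]
    rw [← hstar]
    simp
  · intro x
    have e : star x ⬝ᵥ (G *ᵥ x) = h0 (vecMulVec x (star x)) := by
      rw [← hG, mul_vecMulVec, trace_vecMulVec, dotProduct_comm]
    have hx := posSemidef_vecMulVec_self_star x
    have h1 : g (Complex.I • vecMulVec x (star x)) = 0 := by
      apply hanti
      rw [conjTranspose_smul, hx.isHermitian.eq]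
      simp
    have h2 : 0 ≤ g (vecMulVec x (star x)) := by
      apply hg
      rw [hx.isHermitian.eq]
      exact hx.add hx
    rw [e, hh0, h1]
    simpa using h2

lemma aux_main (P Q R : Matrix n n ℂ)
    (h : ∀ t : ℝ, (P + (t : ℂ) • Q + ((t : ℂ) ^ 2) • R).PosSemidef) (hP : P.PosSemidef)
    (hQ : Q.IsHermitian) (hR : R.PosSemidef) :
    ∃ L : Matrix (n ⊕ n) (n ⊕ n) ℂ, ∀ i j,
      P i j = ∑ k, star (L k (Sum.inl i)) * L k (Sum.inl j) ∧
      Q i j = ∑ k, (star (L k (Sum.inl i)) * L k (Sum.inr j) +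
        star (L k (Sum.inr i)) * L k (Sum.inl j)) ∧
      R i j = ∑ k, star (L k (Sum.inr i)) * L k (Sum.inr j) := by
  obtain ⟨g, hg1, hg2⟩ := aux_ext P Q R h hP hQ hR
  obtain ⟨G, hG, hGg⟩ := aux_choi g hg2
  have hd : ∀ A B C, (G * fromBlocks A B B C).trace =
      (P * A).trace + (Q * B).trace + (R * C).trace := by
    intro A B C
    rw [hGg, fromBlocks_smul, hg1, hg1]
    simp only [Matrix.mul_smul, trace_smul, ← smul_add]
    generalize (P * A).trace + (Q * B).trace + (R * C).trace = z
    apply Complex.ext <;> simp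
  have hd' : ∀ A B C, (G.toBlocks₁₁ * A).trace + (G.toBlocks₁₂ * B).trace +
      ((G.toBlocks₂₁ * B).trace + (G.toBlocks₂₂ * C).trace) =
      (P * A).trace + (Q * B).trace + (R * C).trace := by
    intro A B C
    rw [← hd]
    conv_rhs => rw [← fromBlocks_toBlocks G, fromBlocks_multiply]
    simp [trace, Finset.sum_add_distrib]
  obtain ⟨L, hL⟩ := aux_factor_s11 hG
  have hLe : ∀ a b, G a b = ∑ k, star (L k a) * L k b := by
    intro a b
    rw [hL]; rfl
  refine ⟨L, fun i j => ⟨?_, ?_, ?_⟩⟩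
  · have := hd' (single j i 1) 0 0
    simp [trace_mul_single] at this
    rw [← this, ← hLe]; rfl
  · have := hd' 0 (single j i 1) 0
    simp [trace_mul_single] at this
    rw [← this, Finset.sum_add_distrib, ← hLe, ← hLe]; rfl
  · have := hd' 0 0 (single j i 1)
    simp [trace_mul_single] at this
    rw [← this, ← hLe]; rfl

end aux

/-- Any positive map Φ : M₃(ℂ) → Mₘ(ℂ) admits a Kraus-type representation
Φ(A) = Σᵢ Vᵢᴴ A Vᵢ on all matrices of the form [[a,a,b],[a,a,b],[b,b,c]]. -/
theorem stmt_11 {m : ℕ}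
    (Φ : Matrix (Fin 3) (Fin 3) ℂ →ₗ[ℂ] Matrix (Fin m) (Fin m) ℂ)
    (hΦ : ∀ A : Matrix (Fin 3) (Fin 3) ℂ, A.PosSemidef → (Φ A).PosSemidef) :
    ∃ (k : ℕ) (V : Fin k → Matrix (Fin 3) (Fin m) ℂ),
      ∀ a b c : ℂ,
        Φ !![a, a, b; a, a, b; b, b, c] =
          ∑ i, (V i)ᴴ * !![a, a, b; a, a, b; b, b, c] * V i := by
  obtain ⟨P, Q, R, hlin⟩ : ∃ P Q R, ∀ a b c : ℂ, Φ !![a, a, b; a, a, b; b, b, c] =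
      a • P + b • Q + c • R := by
    refine ⟨Φ !![1, 1, 0; 1, 1, 0; 0, 0, 0], Φ !![0, 0, 1; 0, 0, 1; 1, 1, 0],
      Φ !![0, 0, 0; 0, 0, 0; 0, 0, 1], ?_⟩
    intro a b c
    rw [← Φ.map_smul, ← Φ.map_smul, ← Φ.map_smul, ← Φ.map_add, ← Φ.map_add]
    congr 1
    ext i j
    fin_cases i <;> fin_cases j <;> simp
  have hpos : ∀ x y : ℝ, (Φ !![(x : ℂ) ^ 2, (x : ℂ) ^ 2, (x : ℂ) * y;
      (x : ℂ) ^ 2, (x : ℂ) ^ 2, (x : ℂ) * y; (x : ℂ) * y, (x : ℂ) * y, (y : ℂ) ^ 2]).PosSemidef := by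
    intro x y
    apply hΦ
    have := posSemidef_vecMulVec_self_star (![(x : ℂ), (x : ℂ), (y : ℂ)])
    convert this using 1
    ext i j
    fin_cases i <;> fin_cases j <;> simp [vecMulVec_apply] <;> ring
  simp only [hlin] at hpos ⊢
  have hP : P.PosSemidef := by simpa using hpos 1 0
  have hR : R.PosSemidef := by simpa using hpos 0 1
  have ht : ∀ t : ℝ, (P + (t : ℂ) • Q + ((t : ℂ) ^ 2) • R).PosSemidef := by
    intro t; simpa using hpos 1 t
  have hQ : Q.IsHermitian := by
    have h1 := ((ht 1).isHermitian.sub hP.isHermitian).sub hR.isHermitian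
    convert h1 using 1
    simp
    abel
  obtain ⟨L, hL⟩ := aux_main P Q R ht hP hQ hR
  let e := Fintype.equivFin (Fin m ⊕ Fin m)
  refine ⟨_, fun k => of ![fun i => L (e.symm k) (Sum.inl i), 0,
    fun i => L (e.symm k) (Sum.inr i)], fun a b c => ?_⟩
  ext i j
  obtain ⟨h1, h2, h3⟩ := hL i j
  rw [Matrix.sum_apply]
  simp only [Matrix.add_apply, Matrix.smul_apply, smul_eq_mul, h1, h2, h3, Finset.mul_sum,
    ← Finset.sum_add_distrib]
  rw [← e.symm.sum_comp]
  refine Finset.sum_congr rfl fun k _ => ?_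
  simp [Matrix.mul_apply, Fin.sum_univ_three]
  ring
end
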